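/- arXiv:2407.14215 — 5 statements merged into one kernel-verified Lean document; each statement's English description precedes it below -/
import Mathlib

section
/- Let q : R^n → (−∞,∞] be proper lower semicontinuous convex, F : R^n → R^n continuously differentiable and Lipschitz with modulus ℓ ≥ 0 on the closed ball B_r(x̄), where x̄ is a solution of 0 ∈ F(x̄) + ∂q(x̄), and let γ > 0. Let ε > 0 and let δ, δ_q > 0 satisfy δ ≤ min{δ_q/(1+ℓ), r} together with: (H1) for all (d, d*) with d* ∈ ∂q(d) and ‖(d − x̄, d* + F(x̄))‖ ≤ δ_q, all B ∈ ∂_B P_{γ⁻¹q}(d + γ⁻¹d*) and all v ∈ R^n, writing e := Bv and e* := γ(I − B)v, one has |⟨e*, d − x̄⟩ − ⟨e, d* + F(x̄)⟩| ≤ (ε/(2√2(ℓ+1)))‖(e, e*)‖‖(d − x̄, d* + F(x̄))‖; and (H2) ‖F(x) − F(x̄) − F'(x)(x − x̄)‖ ≤ (ε/(2√2(ℓ+1)))‖x − x̄‖ for all x ∈ B_δ(x̄). Then for every x̂ with ‖x̂ − x̄‖ ≤ min{ min{δ_q, r}/((1 + ℓ/γ)·max{1,γ}), δ }, every v ∈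 R^n and every B ∈ ∂_B P_{γ⁻¹q}(x̂ − γ⁻¹F(x̂)): |⟨γv, u_γ(x̂)⟩ − (⟨γBv, (I − γ⁻¹F'(x̂))(x̂ − x̄)⟩ − ⟨γv, x̂ − x̄⟩)| ≤ (ε/(2√2(ℓ+1)))·( ‖(Bv, γ(I−B)v)‖·max{1,γ}·(1 + ℓ/γ) + ‖Bv‖ )·‖x̂ − x̄‖. -/
open Filter Metric ContinuousLinearMap Asymptotics
open scoped Topology RealInnerProductSpace

noncomputable section

abbrev Eu (n : ℕ) : Type := EuclideanSpace ℝ (Fin n)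

/-- `q` is a proper lower semicontinuous convex function with values in `(-∞, ∞]`. -/
def ProperLscConvex {n : ℕ} (q : Eu n → EReal) : Prop :=
  (∀ x, q x ≠ ⊥) ∧ (∃ x, q x ≠ ⊤) ∧ LowerSemicontinuous q ∧
  (∀ x y : Eu n, ∀ a b : ℝ, 0 ≤ a → 0 ≤ b → a + b = 1 →
    q (a • x + b • y) ≤ (a : EReal) * q x + (b : EReal) * q y)

/-- `P` is the proximal mapping `P_{γ⁻¹ q}`: `P x` is the unique minimizer of
`z ↦ q(z) + (γ/2)‖z − x‖²`. -/
def IsProxOf {n : ℕ} (q : Eu n → EReal) (γ : ℝ) (P : Eu n → Eu n) : Prop :=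
  ∀ x z : Eu n,
    (q (P x) + ((γ / 2 * ‖P x - x‖^2 : ℝ) : EReal) ≤ q z + ((γ / 2 * ‖z - x‖^2 : ℝ) : EReal)) ∧
    (q z + ((γ / 2 * ‖z - x‖^2 : ℝ) : EReal) ≤ q (P x) + ((γ / 2 * ‖P x - x‖^2 : ℝ) : EReal)
      → z = P x)

/-- The convex subdifferential `∂q(y)`. -/
def subdiff {n : ℕ} (q : Eu n → EReal) (y : Eu n) : Set (Eu n) :=
  {v | ∀ z : Eu n, q y + ((⟪v, z - y⟫ : ℝ) : EReal) ≤ q z}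

/-- Bouligand subdifferential: all limits of derivatives along sequences of
differentiability points converging to `x`. -/
def BSubdiff {n m : ℕ} (Φ : Eu n → Eu m) (x : Eu n) : Set (Eu n →L[ℝ] Eu m) :=
  {V | ∃ (u : ℕ → Eu n) (Vk : ℕ → Eu n →L[ℝ] Eu m),
      (∀ k, HasFDerivAt Φ (Vk k) (u k)) ∧
      Tendsto u atTop (𝓝 x) ∧ Tendsto Vk atTop (𝓝 V)}


lemma aux_lim (A C : ℝ) (hC : 0 ≤ C) (h : ∀ t : ℝ, 0 < t → t ≤ 1 → A ≤ t * C) : A ≤ 0 := by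
  by_contra hA
  push Not at hA
  have h1 : 0 < A / (A + C + 1) := by positivity
  have h2 : A / (A + C + 1) ≤ 1 := by
    rw [div_le_one (by positivity)]; linarith
  have h3 := h _ h1 h2
  rw [div_mul_eq_mul_div, le_div_iff₀ (by positivity)] at h3
  nlinarith

lemma aux_fin {n : ℕ} {q : Eu n → EReal} (hq : ProperLscConvex q) {d : Eu n} {c : ℝ} {w : Eu n}
    {e : ℝ} (hw : q w ≠ ⊤) (h : q d + (c : EReal) ≤ q w + (e : EReal)) :
    ∃ s : ℝ, q d = s := by
  have h1 : q d ≠ ⊤ := by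
    intro ht
    rw [ht, EReal.top_add_coe, top_le_iff] at h
    lift q w to ℝ using ⟨hw, hq.1 w⟩ with s hs
    exact EReal.coe_ne_top (s + e) (by rw [EReal.coe_add]; exact h)
  lift q d to ℝ using ⟨h1, hq.1 d⟩ with s hs
  exact ⟨s, rfl⟩

lemma aux_prox {n : ℕ} (q : Eu n → EReal) (hq : ProperLscConvex q)
    (γ : ℝ) (hγ : 0 < γ) (P : Eu n → Eu n) (hP : IsProxOf q γ P) (y : Eu n) :
    γ • (y - P y) ∈ subdiff q (P y) := by
  intro z
  by_cases hz : q z = ⊤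
  · rw [hz]; exact le_top
  obtain ⟨s, hs⟩ := aux_fin hq hz (hP y z).1
  obtain ⟨t, ht⟩ : ∃ t : ℝ, q z = t := by
    lift q z to ℝ using ⟨hz, hq.1 z⟩ with t
    exact ⟨t, rfl⟩
  rw [hs, ht]
  norm_cast
  have key := aux_lim (s + ⟪γ • (y - P y), z - P y⟫ - t) (γ / 2 * ‖z - P y‖ ^ 2) (by positivity) ?_
  · linarith
  intro τ h0 h1
  have hm := (hP y ((1 - τ) • P y + τ • z)).1
  have hc := hq.2.2.2 (P y) z (1 - τ) τ (by linarith) h0.le (by ring)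
  have hm2 := hm.trans (add_le_add_left hc _)
  rw [hs, ht] at hm2
  norm_cast at hm2
  have e : ((1 - τ) • P y + τ • z) - y = (P y - y) + τ • (z - P y) := by module
  have e2 : y - P y = - (P y - y) := by abel
  rw [e, norm_add_sq_real, inner_smul_right, norm_smul, mul_pow, Real.norm_eq_abs, sq_abs] at hm2
  rw [e2, inner_smul_left, inner_neg_left]
  simp only [conj_trivial]
  have : τ * (s + γ * -⟪P y - y, z - P y⟫ - t) ≤ τ * (τ * (γ / 2 * ‖z - P y‖ ^ 2)) := by
    linarith
  exact le_of_mul_le_mul_left this h0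

lemma aux_mono {n : ℕ} (q : Eu n → EReal) (hq : ProperLscConvex q) {d e a b : Eu n}
    (ha : a ∈ subdiff q d) (hb : b ∈ subdiff q e) : 0 ≤ ⟪a - b, d - e⟫ := by
  obtain ⟨w, hw⟩ := hq.2.1
  obtain ⟨s, hs⟩ := aux_fin hq (e := 0) hw (by simpa using ha w)
  obtain ⟨t, ht⟩ := aux_fin hq (e := 0) hw (by simpa using hb w)
  have h1 := ha e
  have h2 := hb d
  rw [hs, ht] at h1 h2
  norm_cast at h1 h2
  rw [← neg_sub d e, inner_neg_right] at h1
  rw [inner_sub_left]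
  linarith

/-- Proposition 5.3(a): the key G-semismoothness estimate for the proximal
residual `u_γ(x) = P_{γ⁻¹q}(x − γ⁻¹F(x)) − x` near a solution `x̄` of `0 ∈ F(x) + ∂q(x)`. -/
theorem stmt7 {n : ℕ} (q : Eu n → EReal) (hq : ProperLscConvex q)
    (γ : ℝ) (hγ : 0 < γ) (P : Eu n → Eu n) (hP : IsProxOf q γ P)
    (F : Eu n → Eu n) (hF : ContDiff ℝ 1 F)
    (xbar : Eu n) (hsol : -F xbar ∈ subdiff q xbar)
    (r : ℝ) (hr : 0 < r) (ℓ : ℝ) (hℓ : 0 ≤ ℓ)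
    (hLip : ∀ x ∈ Metric.closedBall xbar r, ∀ y ∈ Metric.closedBall xbar r,
      ‖F x - F y‖ ≤ ℓ * ‖x - y‖)
    (ε δ δq : ℝ) (hε : 0 < ε) (hδpos : 0 < δ) (hδqpos : 0 < δq)
    (hδ : δ ≤ min (δq / (1 + ℓ)) r)
    (hH1 : ∀ d dstar : Eu n, dstar ∈ subdiff q d →
      Real.sqrt (‖d - xbar‖^2 + ‖dstar + F xbar‖^2) ≤ δq →
      ∀ B ∈ BSubdiff P (d + γ⁻¹ • dstar), ∀ v : Eu n,
        |⟪γ • (v - B v), d - xbar⟫ - ⟪B v, dstar + F xbar⟫| ≤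
          ε / (2 * Real.sqrt 2 * (ℓ + 1)) *
            Real.sqrt (‖B v‖^2 + ‖γ • (v - B v)‖^2) *
            Real.sqrt (‖d - xbar‖^2 + ‖dstar + F xbar‖^2))
    (hH2 : ∀ x ∈ Metric.closedBall xbar δ,
      ‖F x - F xbar - fderiv ℝ F x (x - xbar)‖ ≤
        ε / (2 * Real.sqrt 2 * (ℓ + 1)) * ‖x - xbar‖) :
    ∀ xh : Eu n,
      ‖xh - xbar‖ ≤ min (min δq r / ((1 + ℓ / γ) * max 1 γ)) δ →
      ∀ v : Eu n, ∀ B ∈ BSubdiff P (xh - γ⁻¹ • F xh),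
        |⟪γ • v, P (xh - γ⁻¹ • F xh) - xh⟫ -
            (⟪γ • B v, (xh - xbar) - γ⁻¹ • fderiv ℝ F xh (xh - xbar)⟫ -
              ⟪γ • v, xh - xbar⟫)| ≤
          ε / (2 * Real.sqrt 2 * (ℓ + 1)) *
            (Real.sqrt (‖B v‖^2 + ‖γ • (v - B v)‖^2) * max 1 γ * (1 + ℓ / γ) + ‖B v‖) *
            ‖xh - xbar‖ := by
  intro xh hxh v B hB
  set c := ε / (2 * Real.sqrt 2 * (ℓ + 1)) with hc
  have hc0 : 0 ≤ c := by positivity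
  have hx1 := hxh.trans (min_le_left _ _)
  have hx2 := hxh.trans (min_le_right _ _)
  have hM : 0 < (1 + ℓ / γ) * max 1 γ := by positivity
  rw [le_div_iff₀ hM] at hx1
  have hx3 : ‖xh - xbar‖ * ((1 + ℓ / γ) * max 1 γ) ≤ δq := hx1.trans (min_le_left _ _)
  have hL : ‖F xh - F xbar‖ ≤ ℓ * ‖xh - xbar‖ := by
    apply hLip
    · rw [mem_closedBall, dist_eq_norm]
      exact hx2.trans (hδ.trans (min_le_right _ _))
    · exact mem_closedBall_self hr.le
  have h2 := hH2 xh (by rw [mem_closedBall, dist_eq_norm]; exact hx2)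
  set y := xh - γ⁻¹ • F xh with hy
  set d := P y with hd
  have hds : γ • (y - d) ∈ subdiff q d := aux_prox q hq γ hγ P hP y
  set w := (xh - xbar) - γ⁻¹ • (F xh - F xbar) with hw
  set a := d - xbar with ha
  have hdF : γ • (y - d) + F xbar = γ • (w - a) := by
    have : F xbar = γ • γ⁻¹ • F xbar := by rw [smul_smul, mul_inv_cancel₀ hγ.ne', one_smul]
    rw [hw, ha, hy]
    nth_rewrite 1 [this]
    module
  have hmon := aux_mono q hq hds hsol
  rw [sub_neg_eq_add, hdF, inner_smul_left] at hmon
  simp only [conj_trivial] at hmon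
  have hmon' : 0 ≤ ⟪w - a, a⟫ := nonneg_of_mul_nonneg_right hmon hγ
  have hnw : ‖w‖ ^ 2 = ‖w - a‖ ^ 2 + 2 * ⟪w - a, a⟫ + ‖a‖ ^ 2 := by
    rw [← norm_add_sq_real, sub_add_cancel]
  have hwn : ‖w‖ ≤ (1 + ℓ / γ) * ‖xh - xbar‖ := by
    calc ‖w‖ ≤ ‖xh - xbar‖ + ‖γ⁻¹ • (F xh - F xbar)‖ := norm_sub_le _ _
      _ = ‖xh - xbar‖ + γ⁻¹ * ‖F xh - F xbar‖ := by
        rw [norm_smul, Real.norm_of_nonneg (by positivity)]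
      _ ≤ ‖xh - xbar‖ + γ⁻¹ * (ℓ * ‖xh - xbar‖) := by gcongr
      _ = _ := by ring
  have hS : Real.sqrt (‖a‖ ^ 2 + ‖γ • (y - d) + F xbar‖ ^ 2) ≤
      max 1 γ * (1 + ℓ / γ) * ‖xh - xbar‖ := by
    have h1 : Real.sqrt (‖a‖ ^ 2 + ‖γ • (y - d) + F xbar‖ ^ 2) ≤ max 1 γ * ‖w‖ := by
      apply Real.sqrt_le_iff.2 ⟨by positivity, ?_⟩
      rw [hdF, norm_smul, Real.norm_of_nonneg hγ.le, mul_pow, mul_pow, hnw]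
      have m1 : 1 ≤ max 1 γ ^ 2 := one_le_pow₀ (le_max_left _ _)
      have m2 : γ ^ 2 ≤ max 1 γ ^ 2 := pow_le_pow_left₀ hγ.le (le_max_right _ _) 2
      have m3 := mul_le_mul_of_nonneg_right m1 (sq_nonneg ‖a‖)
      have m4 := mul_le_mul_of_nonneg_right m2 (sq_nonneg ‖w - a‖)
      have m5 := mul_nonneg (sq_nonneg (max 1 γ)) hmon'
      linarith
    refine h1.trans ?_
    rw [mul_assoc]
    gcongr
  have hyd : d + γ⁻¹ • γ • (y - d) = y := by
    rw [smul_smul, inv_mul_cancel₀ hγ.ne', one_smul]; abel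
  have h1 := hH1 d (γ • (y - d)) hds (hS.trans (by linarith)) B (by rw [hyd]; exact hB) v
  have h1' := h1.trans (mul_le_mul_of_nonneg_left hS (by positivity))
  rw [hdF] at h1'
  have hcs : |⟪B v, F xh - F xbar - fderiv ℝ F xh (xh - xbar)⟫| ≤ ‖B v‖ * (c * ‖xh - xbar‖) :=
    (abs_real_inner_le_norm _ _).trans (by gcongr)
  have hid : ⟪γ • v, d - xh⟫ -
            (⟪γ • B v, (xh - xbar) - γ⁻¹ • fderiv ℝ F xh (xh - xbar)⟫ -
              ⟪γ • v, xh - xbar⟫) =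
      (⟪γ • (v - B v), a⟫ - ⟪B v, γ • (w - a)⟫)
        - ⟪B v, F xh - F xbar - fderiv ℝ F xh (xh - xbar)⟫ := by
    have e1 : d - xh = a - (xh - xbar) := by rw [ha]; abel
    rw [e1, hw]
    generalize fderiv ℝ F xh (xh - xbar) = D
    simp only [inner_smul_left, inner_smul_right, inner_sub_left, inner_sub_right, conj_trivial]
    field_simp
    ring
  rw [hid]
  refine (abs_sub _ _).trans ?_
  refine (add_le_add h1' hcs).trans (le_of_eq ?_)
  ring
end
end

section
/- Let q : R^n → (−∞,∞] be proper lower semicontinuous convex, F : R^n → R^n continuously differentiable and Lipschitz with modulus ℓ ≥ 0 on the closed ball B_r(x̄), where x̄ is a solution of 0 ∈ F(x̄) + ∂q(x̄), and let γ > 0. Let ε > 0 and let δ, δ_q > 0 satisfy δ ≤ min{δ_q/(1+ℓ), r} together with hypotheses (H1) and (H2). Then for every x̂ with ‖x̂ − x̄‖ ≤ min{ min{δ_q, r}/((1 + ℓ/γ)·max{1,γ}), δ } and every B ∈ ∂_B P_{γ⁻¹q}(x̂ − γ⁻¹F(x̂)) such that C := B(I − γ⁻¹F'(x̂)) − I is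 nonsingular, setting M := γCᵀ, one has ‖C⁻¹u_γ(x̂) − (x̂ − x̄)‖ ≤ (ε/(2√2(ℓ+1)))·( max{1,γ}·(1 + ℓ/γ)·‖(BM⁻¹; γ(I−B)M⁻¹)‖_F + ‖BM⁻¹‖_F )·‖x̂ − x̄‖, where ‖·‖_F is the Frobenius norm and (BM⁻¹; γ(I−B)M⁻¹) is the 2n×n stacked matrix. -/
open Filter Metric ContinuousLinearMap Asymptotics
open scoped Topology RealInnerProductSpace

noncomputable section

/-- Frobenius norm of an operator between Euclidean spaces (square root of the sum of the
squared norms of its columns). -/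
def frobNorm {n m : ℕ} (A : Eu n →L[ℝ] Eu m) : ℝ :=
  Real.sqrt (∑ i : Fin n, ‖A (EuclideanSpace.single i (1:ℝ))‖^2)


lemma aux_fin_s8 {n : ℕ} {q : Eu n → EReal} (hq : ProperLscConvex q) {γ : ℝ}
    {P : Eu n → Eu n} (hP : IsProxOf q γ P) (y : Eu n) : q (P y) ≠ ⊤ := by
  obtain ⟨x0, hx0⟩ := hq.2.1
  intro h
  have h1 := (hP y x0).1
  rw [h, EReal.top_add_coe, top_le_iff] at h1
  lift q x0 to ℝ using ⟨hx0, hq.1 x0⟩ with a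
  exact EReal.coe_ne_top _ (by exact_mod_cast h1)

lemma aux_subfin {n : ℕ} {q : Eu n → EReal} (hq : ProperLscConvex q) {x v : Eu n}
    (h : v ∈ subdiff q x) : q x ≠ ⊤ := by
  obtain ⟨x0, hx0⟩ := hq.2.1
  intro hx
  have h1 := h x0
  rw [hx, EReal.top_add_coe, top_le_iff] at h1
  exact hx0 h1

lemma aux_sub {n : ℕ} {q : Eu n → EReal} (hq : ProperLscConvex q) {γ : ℝ} (hγ : 0 < γ)
    {P : Eu n → Eu n} (hP : IsProxOf q γ P) (y : Eu n) :
    γ • (y - P y) ∈ subdiff q (P y) := by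
  intro z
  by_cases hz : q z = ⊤
  · rw [hz]; exact le_top
  have hd := aux_fin_s8 hq hP y
  obtain ⟨a, ha⟩ : ∃ a : ℝ, q (P y) = a := ⟨_, (EReal.coe_toReal hd (hq.1 _)).symm⟩
  obtain ⟨b, hb⟩ : ∃ b : ℝ, q z = b := ⟨_, (EReal.coe_toReal hz (hq.1 _)).symm⟩
  rw [ha, hb]
  norm_cast
  set d := P y with hdd
  have key : ∀ t : ℝ, 0 < t → t ≤ 1 →
      a + γ * ⟪y - d, z - d⟫ - b ≤ t * (γ / 2 * ‖z - d‖ ^ 2) := by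
    intro t ht ht1
    have h1 := (hP y ((1 - t) • d + t • z)).1
    have h2 := hq.2.2.2 d z (1 - t) t (by linarith) ht.le (by ring)
    rw [ha, hb] at h2
    rw [← hdd, ha] at h1
    have h3 := h1.trans (add_le_add_left h2 _)
    norm_cast at h3
    have e : (1 - t) • d + t • z - y = (d - y) + t • (z - d) := by module
    rw [e, norm_add_sq_real, inner_smul_right, norm_smul, mul_pow, Real.norm_eq_abs, sq_abs] at h3
    have e2 : ⟪d - y, z - d⟫ = - ⟪y - d, z - d⟫ := by
      rw [← inner_neg_left, neg_sub]
    rw [e2] at h3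
    have : t * (a + γ * ⟪y - d, z - d⟫ - b) ≤ t * (t * (γ / 2 * ‖z - d‖ ^ 2)) := by
      nlinarith
    exact le_of_mul_le_mul_left this ht
  rw [inner_smul_left]
  simp only [conj_trivial]
  by_contra! hcon
  set A := a + γ * ⟪y - d, z - d⟫ - b with hA
  have hApos : 0 < A := by rw [hA]; linarith
  set K := γ / 2 * ‖z - d‖ ^ 2 with hK
  have hK0 : 0 ≤ K := by positivity
  have h5 := key (A / (A + K + K + 1)) (by positivity)
    (by rw [div_le_one (by positivity)]; linarith)
  have : A / (A + K + K + 1) * K < A := by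
    rw [div_mul_eq_mul_div, div_lt_iff₀ (by positivity)]
    nlinarith
  linarith

lemma aux_mono_s8 {n : ℕ} {q : Eu n → EReal} (hq : ProperLscConvex q) {x v y w : Eu n}
    (h : v ∈ subdiff q x) (h' : w ∈ subdiff q y) : 0 ≤ ⟪v - w, x - y⟫ := by
  have h1 := h y
  have h2 := h' x
  have hx := aux_subfin hq h
  have hy := aux_subfin hq h'
  obtain ⟨a, ha⟩ : ∃ a : ℝ, q x = a := ⟨_, (EReal.coe_toReal hx (hq.1 _)).symm⟩
  obtain ⟨b, hb⟩ : ∃ b : ℝ, q y = b := ⟨_, (EReal.coe_toReal hy (hq.1 _)).symm⟩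
  rw [ha, hb] at h1 h2
  norm_cast at h1 h2
  have e : ⟪v, y - x⟫ = - ⟪v, x - y⟫ := by rw [← inner_neg_right, neg_sub]
  rw [inner_sub_left]
  linarith

lemma aux_symm {n : ℕ} {q : Eu n → EReal} (hq : ProperLscConvex q) {γ : ℝ} (hγ : 0 < γ)
    {P : Eu n → Eu n} (hP : IsProxOf q γ P) (y : Eu n) (V : Eu n →L[ℝ] Eu n)
    (hV : HasFDerivAt P V y) (v w : Eu n) : ⟪V v, w⟫ = ⟪v, V w⟫ := by
  set φ : Eu n → ℝ := fun y => ⟪y, P y⟫ - 1 / 2 * ‖P y‖ ^ 2 - γ⁻¹ * (q (P y)).toReal with hφ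
  have hlow : ∀ y z : Eu n, φ y + ⟪P y, z - y⟫ ≤ φ z := by
    intro y z
    have h1 := (hP z (P y)).1
    rw [← EReal.coe_toReal (aux_fin_s8 hq hP y) (hq.1 _),
      ← EReal.coe_toReal (aux_fin_s8 hq hP z) (hq.1 _)] at h1
    norm_cast at h1
    rw [norm_sub_sq_real, norm_sub_sq_real] at h1
    have h2 := mul_le_mul_of_nonneg_left h1 (inv_pos.2 hγ).le
    have e1 : ∀ a b : ℝ, γ⁻¹ * (a + γ / 2 * b) = γ⁻¹ * a + b / 2 := by
      intro a b; field_simp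
    rw [e1, e1] at h2
    simp only [hφ]
    rw [inner_sub_right, real_inner_comm (P y) y, real_inner_comm (P z) z]
    linarith
  have hne : ∀ y z : Eu n, ‖P z - P y‖ ≤ ‖z - y‖ := by
    intro y z
    have h1 := aux_mono_s8 hq (aux_sub hq hγ hP z) (aux_sub hq hγ hP y)
    have e : γ • (z - P z) - γ • (y - P y) = γ • ((z - y) - (P z - P y)) := by module
    rw [e, inner_smul_left, inner_sub_left, real_inner_self_eq_norm_sq] at h1
    simp only [conj_trivial] at h1
    have h2 := nonneg_of_mul_nonneg_right h1 hγ
    have h3 := real_inner_le_norm (z - y) (P z - P y)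
    by_contra! hc
    nlinarith [norm_nonneg (z - y), norm_nonneg (P z - P y)]
  have hder : ∀ y, HasFDerivAt φ (innerSL ℝ (P y)) y := by
    intro y
    rw [hasFDerivAt_iff_isLittleO]
    have : (fun z => φ z - φ y - innerSL ℝ (P y) (z - y)) =O[𝓝 y] fun z => ‖z - y‖ ^ 2 := by
      refine IsBigO.of_bound 1 (Eventually.of_forall fun z => ?_)
      have h1 := hlow y z
      have h2 := hlow z y
      have h3 := real_inner_le_norm (P z - P y) (z - y)
      have h4 := hne y z
      have e : ⟪P z, y - z⟫ = - ⟪P z, z - y⟫ := by rw [← inner_neg_right, neg_sub]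
      rw [inner_sub_left] at h3
      simp only [innerSL_apply_apply, norm_pow, one_mul, Real.norm_eq_abs, abs_norm]
      rw [abs_of_nonneg (by linarith)]
      nlinarith [norm_nonneg (z - y), norm_nonneg (P z - P y)]
    refine this.trans_isLittleO ?_
    exact isLittleO_pow_sub_sub y one_lt_two
  have h2 := second_derivative_symmetric_of_eventually (f := φ)
    (f' := fun y => innerSL ℝ (P y)) (f'' := (innerSL ℝ (E := Eu n)).comp V) (x := y)
    (Eventually.of_forall hder) ((innerSL ℝ (E := Eu n)).hasFDerivAt.comp y hV) v w
  simp only [ContinuousLinearMap.comp_apply, innerSL_apply_apply] at h2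
  rw [h2, real_inner_comm]

lemma aux_symmB {n : ℕ} {q : Eu n → EReal} (hq : ProperLscConvex q) {γ : ℝ} (hγ : 0 < γ)
    {P : Eu n → Eu n} (hP : IsProxOf q γ P) (y : Eu n) (B : Eu n →L[ℝ] Eu n)
    (hB : B ∈ BSubdiff P y) (v w : Eu n) : ⟪B v, w⟫ = ⟪v, B w⟫ := by
  obtain ⟨u, Vk, h1, -, h3⟩ := hB
  have ha : ∀ z, Tendsto (fun k => Vk k z) atTop (𝓝 (B z)) := fun z =>
    ((ContinuousLinearMap.apply ℝ (Eu n) z).continuous.tendsto B).comp h3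
  have t1 := (ha v).inner (𝕜 := ℝ) (tendsto_const_nhds (x := w))
  have t2 := (tendsto_const_nhds (x := v)).inner (𝕜 := ℝ) (ha w)
  refine tendsto_nhds_unique t1 (t2.congr fun k => ?_)
  exact (aux_symm hq hγ hP (u k) (Vk k) (h1 k) v w).symm

lemma aux_frob {n m : ℕ} (A : Eu n →L[ℝ] Eu m) (z : Eu n) : ‖A z‖ ≤ frobNorm A * ‖z‖ := by
  have e : z = ∑ i, z i • EuclideanSpace.single i (1:ℝ) := by
    ext j; simp [Finset.sum_apply, Pi.single_apply]
  have h1 : ‖A z‖ ≤ ∑ i, ‖A (EuclideanSpace.single i (1:ℝ))‖ * ‖z i‖ := by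
    conv_lhs => rw [e]
    rw [map_sum]
    refine (norm_sum_le _ _).trans (Finset.sum_le_sum fun i _ => ?_)
    rw [map_smul, norm_smul, mul_comm]
  refine h1.trans ?_
  rw [frobNorm, EuclideanSpace.norm_eq]
  exact Real.sum_mul_le_sqrt_mul_sqrt _ _ _

lemma aux_frob_mul {n : ℕ} (B D : Eu n →L[ℝ] Eu n) (z : Eu n) :
    ‖B (D z)‖ ≤ frobNorm (B * D) * ‖z‖ := aux_frob (B * D) z

lemma aux_frob_mul2 {n : ℕ} (B D : Eu n →L[ℝ] Eu n) (γ : ℝ) (z : Eu n) :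
    ‖γ • (D z - B (D z))‖ ≤ frobNorm ((γ • (1 - B)) * D) * ‖z‖ := by
  have h := aux_frob ((γ • (1 - B)) * D) z
  have e : ((γ • (1 - B)) * D) z = γ • (D z - B (D z)) := by simp
  rwa [e] at h

set_option maxHeartbeats 400000 in
/-- Proposition 5.3(b): the Newton-step estimate for the proximal residual.
For `B ∈ ∂_B P_{γ⁻¹q}(x̂ − γ⁻¹F(x̂))` with `C := B(I − γ⁻¹F'(x̂)) − I` nonsingular and
`M := γCᵀ`, one has the bound on `‖C⁻¹u_γ(x̂) − (x̂ − x̄)‖` in terms of Frobenius norms. -/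
theorem stmt8 {n : ℕ} (q : Eu n → EReal) (hq : ProperLscConvex q)
    (γ : ℝ) (hγ : 0 < γ) (P : Eu n → Eu n) (hP : IsProxOf q γ P)
    (F : Eu n → Eu n) (hF : ContDiff ℝ 1 F)
    (xbar : Eu n) (hsol : -F xbar ∈ subdiff q xbar)
    (r : ℝ) (hr : 0 < r) (ℓ : ℝ) (hℓ : 0 ≤ ℓ)
    (hLip : ∀ x ∈ Metric.closedBall xbar r, ∀ y ∈ Metric.closedBall xbar r,
      ‖F x - F y‖ ≤ ℓ * ‖x - y‖)
    (ε δ δq : ℝ) (hε : 0 < ε) (hδpos : 0 < δ) (hδqpos : 0 < δq)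
    (hδ : δ ≤ min (δq / (1 + ℓ)) r)
    (hH1 : ∀ d dstar : Eu n, dstar ∈ subdiff q d →
      Real.sqrt (‖d - xbar‖^2 + ‖dstar + F xbar‖^2) ≤ δq →
      ∀ B ∈ BSubdiff P (d + γ⁻¹ • dstar), ∀ v : Eu n,
        |⟪γ • (v - B v), d - xbar⟫ - ⟪B v, dstar + F xbar⟫| ≤
          ε / (2 * Real.sqrt 2 * (ℓ + 1)) *
            Real.sqrt (‖B v‖^2 + ‖γ • (v - B v)‖^2) *
            Real.sqrt (‖d - xbar‖^2 + ‖dstar + F xbar‖^2))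
    (hH2 : ∀ x ∈ Metric.closedBall xbar δ,
      ‖F x - F xbar - fderiv ℝ F x (x - xbar)‖ ≤
        ε / (2 * Real.sqrt 2 * (ℓ + 1)) * ‖x - xbar‖) :
    ∀ xh : Eu n,
      ‖xh - xbar‖ ≤ min (min δq r / ((1 + ℓ / γ) * max 1 γ)) δ →
      ∀ B ∈ BSubdiff P (xh - γ⁻¹ • F xh),
        IsUnit (B * (1 - γ⁻¹ • fderiv ℝ F xh) - 1) →
        ‖(Ring.inverse (B * (1 - γ⁻¹ • fderiv ℝ F xh) - 1))
              (P (xh - γ⁻¹ • F xh) - xh) - (xh - xbar)‖ ≤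
          ε / (2 * Real.sqrt 2 * (ℓ + 1)) *
            (max 1 γ * (1 + ℓ / γ) *
              Real.sqrt
                ((frobNorm (B *
                    Ring.inverse (γ • adjoint (B * (1 - γ⁻¹ • fderiv ℝ F xh) - 1))))^2 +
                  (frobNorm ((γ • (1 - B)) *
                    Ring.inverse (γ • adjoint (B * (1 - γ⁻¹ • fderiv ℝ F xh) - 1))))^2) +
              frobNorm (B *
                Ring.inverse (γ • adjoint (B * (1 - γ⁻¹ • fderiv ℝ F xh) - 1)))) *
            ‖xh - xbar‖ := by
  intro x hx B hB hC
  set κ := ε / (2 * Real.sqrt 2 * (ℓ + 1)) with hκ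
  have hκ0 : 0 ≤ κ := by positivity
  set F' := fderiv ℝ F x with hF'
  set C := B * (1 - γ⁻¹ • F') - 1 with hCdef
  set M := γ • adjoint C with hM
  have hMu : IsUnit M := by
    have h1 : IsUnit (adjoint C) := by
      have := hC.star
      rwa [ContinuousLinearMap.star_eq_adjoint] at this
    have h2 : M = (Units.mk0 γ hγ.ne') • adjoint C := rfl
    rw [h2]
    exact h1.smul (Units.mk0 γ hγ.ne')
  set d := P (x - γ⁻¹ • F x) with hd
  have hsub := aux_sub hq hγ hP (x - γ⁻¹ • F x)
  rw [← hd] at hsub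
  set ds := γ • (x - γ⁻¹ • F x - d) with hds
  have hdsum : d + γ⁻¹ • ds = x - γ⁻¹ • F x := by
    rw [hds, smul_smul, inv_mul_cancel₀ hγ.ne', one_smul]; abel
  have hds2 : ds = γ • (x - d) - F x := by
    rw [hds, smul_sub, smul_sub, smul_sub, smul_smul, mul_inv_cancel₀ hγ.ne', one_smul]; abel
  have hxδ : ‖x - xbar‖ ≤ δ := hx.trans (min_le_right _ _)
  have hxr : ‖x - xbar‖ ≤ r := hxδ.trans (hδ.trans (min_le_right _ _))
  have hL : ‖F x - F xbar‖ ≤ ℓ * ‖x - xbar‖ :=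
    hLip x (by rwa [mem_closedBall_iff_norm]) xbar (mem_closedBall_self hr.le)
  -- bound on the pair
  have hR : Real.sqrt (‖d - xbar‖^2 + ‖ds + F xbar‖^2) ≤
      max 1 γ * (1 + ℓ / γ) * ‖x - xbar‖ := by
    have hm := aux_mono_s8 hq hsub hsol
    rw [sub_neg_eq_add] at hm
    set a := d - xbar with ha
    set b := γ⁻¹ • (ds + F xbar) with hb
    have hb' : ds + F xbar = γ • b := by
      rw [hb, smul_smul, mul_inv_cancel₀ hγ.ne', one_smul]
    rw [hb', inner_smul_left] at hm
    simp only [conj_trivial] at hm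
    have hm2 := nonneg_of_mul_nonneg_right hm hγ
    have hab : b + a = (x - xbar) - γ⁻¹ • (F x - F xbar) := by
      have : d = x - γ⁻¹ • F x - γ⁻¹ • ds := by rw [← hdsum]; abel
      rw [ha, hb, this]; module
    have hn : ‖b + a‖ ≤ (1 + ℓ / γ) * ‖x - xbar‖ := by
      rw [hab]
      refine (norm_sub_le _ _).trans ?_
      rw [norm_smul, Real.norm_of_nonneg (inv_pos.2 hγ).le]
      have := mul_le_mul_of_nonneg_left hL (inv_pos.2 hγ).le
      have e : (1 + ℓ / γ) * ‖x - xbar‖ = ‖x - xbar‖ + γ⁻¹ * (ℓ * ‖x - xbar‖) := by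
        field_simp
      linarith
    have hsq := norm_add_sq_real b a
    rw [hb', norm_smul, Real.norm_of_nonneg hγ.le, mul_assoc]
    refine Real.sqrt_le_iff.2 ⟨by positivity, ?_⟩
    have hm1 : 1 ≤ max 1 γ := le_max_left _ _
    have hmγ : γ ≤ max 1 γ := le_max_right _ _
    have p1 : ‖a‖ ^ 2 ≤ (max 1 γ) ^ 2 * ‖a‖ ^ 2 :=
      le_mul_of_one_le_left (by positivity) (one_le_pow₀ hm1)
    have p2 : (γ * ‖b‖) ^ 2 ≤ (max 1 γ) ^ 2 * ‖b‖ ^ 2 := by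
      rw [mul_pow]; gcongr
    have p3 : (max 1 γ) ^ 2 * (‖a‖ ^ 2 + ‖b‖ ^ 2) ≤ (max 1 γ) ^ 2 * ‖b + a‖ ^ 2 := by
      gcongr; linarith
    have p4 : (max 1 γ) ^ 2 * ‖b + a‖ ^ 2 ≤ (max 1 γ) ^ 2 * ((1 + ℓ / γ) * ‖x - xbar‖) ^ 2 := by
      gcongr
    rw [mul_pow]
    linarith
  have hRδ : Real.sqrt (‖d - xbar‖^2 + ‖ds + F xbar‖^2) ≤ δq := by
    have h1 := hx.trans (min_le_left _ _)
    have hpos : 0 < (1 + ℓ / γ) * max 1 γ := by positivity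
    rw [le_div_iff₀ hpos] at h1
    have h2 : min δq r ≤ δq := min_le_left _ _
    refine hR.trans ?_
    linarith
  set z := (Ring.inverse C) (d - x) - (x - xbar) with hz
  set v := (Ring.inverse M) z with hv
  have hMv : γ • (adjoint C) v = z := by
    have : (M * Ring.inverse M) z = z := by rw [Ring.mul_inverse_cancel _ hMu]; rfl
    exact this
  have hCz : C z = (d - x) - C (x - xbar) := by
    have : (C * Ring.inverse C) (d - x) = d - x := by rw [Ring.mul_inverse_cancel _ hC]; rfl
    rw [hz, map_sub]
    congr 1
  have hCx : C (x - xbar) = B (x - xbar) - γ⁻¹ • B (F' (x - xbar)) - (x - xbar) := by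
    rw [hCdef]
    simp
  have hzz : ‖z‖ ^ 2 = (⟪γ • (v - B v), d - xbar⟫ - ⟪B v, ds + F xbar⟫)
      - ⟪B v, F x - F xbar - F' (x - xbar)⟫ := by
    have e1 : ‖z‖ ^ 2 = γ * ⟪v, C z⟫ := by
      rw [← real_inner_self_eq_norm_sq]
      nth_rewrite 1 [← hMv]
      rw [inner_smul_left, adjoint_inner_left]; rfl
    have e2 : C z = (d - xbar) - B (x - xbar) + γ⁻¹ • B (F' (x - xbar)) := by
      rw [hCz, hCx]; abel
    have e3 : ds + F xbar = γ • ((x - xbar) - (d - xbar)) - (F x - F xbar) := by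
      rw [hds2, sub_sub_sub_cancel_right]; abel
    rw [e1, e2, e3]
    simp only [inner_add_right, inner_sub_right, inner_smul_left, inner_smul_right,
      inner_sub_left, aux_symmB hq hγ hP _ B hB, conj_trivial, map_sub, map_smul, smul_sub]
    field_simp
    ring
  have h1 := hH1 d ds hsub hRδ B (by rw [hdsum]; exact hB) v
  have h2 := hH2 x (by rwa [mem_closedBall_iff_norm])
  have h3 : |⟪B v, F x - F xbar - F' (x - xbar)⟫| ≤ ‖B v‖ * (κ * ‖x - xbar‖) :=
    (abs_real_inner_le_norm _ _).trans (by gcongr)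
  have g1 : ‖B v‖ ≤ frobNorm (B * Ring.inverse M) * ‖z‖ :=
    aux_frob_mul B (Ring.inverse M) z
  have g2 : ‖γ • (v - B v)‖ ≤ frobNorm ((γ • (1 - B)) * Ring.inverse M) * ‖z‖ :=
    aux_frob_mul2 B (Ring.inverse M) γ z
  have hf1 : 0 ≤ frobNorm (B * Ring.inverse M) := Real.sqrt_nonneg _
  generalize frobNorm (B * Ring.inverse M) = f1 at *
  generalize frobNorm ((γ • (1 - B)) * Ring.inverse M) = f2 at *
  have g3 : Real.sqrt (‖B v‖^2 + ‖γ • (v - B v)‖^2) ≤ Real.sqrt (f1 ^ 2 + f2 ^ 2) * ‖z‖ := by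
    refine Real.sqrt_le_iff.2 ⟨by positivity, ?_⟩
    rw [mul_pow, Real.sq_sqrt (by positivity), add_mul, ← mul_pow, ← mul_pow]
    gcongr
  have main : ‖z‖ * ‖z‖ ≤ (κ * (max 1 γ * (1 + ℓ / γ) * Real.sqrt (f1 ^ 2 + f2 ^ 2) + f1) *
      ‖x - xbar‖) * ‖z‖ := by
    have k1 : κ * Real.sqrt (‖B v‖^2 + ‖γ • (v - B v)‖^2) *
            Real.sqrt (‖d - xbar‖^2 + ‖ds + F xbar‖^2) ≤
        κ * (Real.sqrt (f1 ^ 2 + f2 ^ 2) * ‖z‖) * (max 1 γ * (1 + ℓ / γ) * ‖x - xbar‖) := by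
      gcongr
    have k2 : ‖B v‖ * (κ * ‖x - xbar‖) ≤ f1 * ‖z‖ * (κ * ‖x - xbar‖) := by gcongr
    have k3 := (abs_le.1 h1).2
    have k4 := (abs_le.1 h3).1
    rw [← sq, hzz]
    linarith
  rcases (norm_nonneg z).eq_or_lt with h0 | h0
  · rw [← h0]
    positivity
  · exact le_of_mul_le_mul_right main h0
end
end

section
/- Let q : R^n → (−∞,∞] be proper lower semicontinuous convex, F : R^n → R^n continuously differentiable, and let x̄ solve 0 ∈ F(x̄) + ∂q(x̄). For γ > 0 define T_{u_γ}(x̄) := { B(I − γ⁻¹F'(x̄)) − I : B ∈ ∂_B P_{γ⁻¹q}(x̄ − γ⁻¹F(x̄)) }. If for some γ₀ > 0 every element of T_{u_{γ₀}}(x̄) is nonsingular, then for every γ > 0 every element of T_{u_γ}(x̄) is nonsingular. (Both conditions are equivalent to SCD regularity of F + ∂q around (x̄, 0).) -/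
open Filter Metric ContinuousLinearMap Asymptotics
open scoped Topology RealInnerProductSpace

noncomputable section

lemma prox_fin {n : ℕ} {q : Eu n → EReal} (hq : ProperLscConvex q) {γ : ℝ}
    {P : Eu n → Eu n} (hP : IsProxOf q γ P) (x : Eu n) : ∃ r : ℝ, q (P x) = r := by
  obtain ⟨hb, ⟨z, hz⟩, -, -⟩ := hq
  have h := (hP x z).1
  have ht : q (P x) ≠ ⊤ := by
    intro ht
    rw [ht, EReal.top_add_coe, top_le_iff] at h
    lift q z to ℝ using ⟨hz, hb z⟩ with s
    rw [← EReal.coe_add] at h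
    exact EReal.coe_ne_top _ h
  exact ⟨_, (EReal.coe_toReal ht (hb _)).symm⟩

lemma prox_sub {n : ℕ} {q : Eu n → EReal} (hq : ProperLscConvex q) {γ : ℝ}
    {P : Eu n → Eu n} (hP : IsProxOf q γ P) (x : Eu n) :
    γ • (x - P x) ∈ subdiff q (P x) := by
  intro z
  obtain ⟨r, hr⟩ := prox_fin hq hP x
  by_cases hz : q z = ⊤
  · rw [hz]; exact le_top
  obtain ⟨s, hs⟩ : ∃ s : ℝ, q z = s := ⟨_, (EReal.coe_toReal hz (hq.1 _)).symm⟩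
  have key : ∀ a : ℝ, 0 < a → a ≤ 1 →
      0 ≤ (s - r - γ * ⟪x - P x, z - P x⟫) + a * (γ / 2 * ‖z - P x‖ ^ 2) := by
    intro a ha ha1
    have h1 := (hP x ((1 - a) • P x + a • z)).1
    have h2 := hq.2.2.2 (P x) z (1 - a) a (by linarith) ha.le (by ring)
    rw [hr, hs, ← EReal.coe_mul, ← EReal.coe_mul, ← EReal.coe_add] at h2
    have h3 := h1.trans (add_le_add_left h2 _)
    rw [hr, ← EReal.coe_add, ← EReal.coe_add, EReal.coe_le_coe_iff] at h3
    have e : (1 - a) • P x + a • z - x = (P x - x) + a • (z - P x) := by module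
    rw [e, norm_add_sq_real, norm_smul, mul_pow, inner_smul_right, Real.norm_eq_abs, sq_abs] at h3
    have e2 : ⟪x - P x, z - P x⟫ = - ⟪P x - x, z - P x⟫ := by
      rw [← inner_neg_left, neg_sub]
    rw [e2]
    have : 0 ≤ a * ((s - r - γ * - ⟪P x - x, z - P x⟫) + a * (γ / 2 * ‖z - P x‖ ^ 2)) := by
      linarith
    exact nonneg_of_mul_nonneg_right this ha
  have hlim : 0 ≤ s - r - γ * ⟪x - P x, z - P x⟫ := by
    have ht : Tendsto (fun a : ℝ => (s - r - γ * ⟪x - P x, z - P x⟫) +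
        a * (γ / 2 * ‖z - P x‖ ^ 2)) (𝓝[>] 0)
        (𝓝 ((s - r - γ * ⟪x - P x, z - P x⟫) + 0 * (γ / 2 * ‖z - P x‖ ^ 2))) := by
      apply Tendsto.mono_left _ nhdsWithin_le_nhds
      apply Continuous.tendsto
      fun_prop
    rw [zero_mul, add_zero] at ht
    refine ge_of_tendsto ht ?_
    filter_upwards [Ioc_mem_nhdsGT (zero_lt_one' ℝ)] with a ha
    exact key a ha.1 ha.2
  rw [hr, hs, ← EReal.coe_add, EReal.coe_le_coe_iff, inner_smul_left]
  simp only [conj_trivial]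
  linarith

lemma prox_eq {n : ℕ} {q : Eu n → EReal} {γ : ℝ} (hγ : 0 < γ)
    {P : Eu n → Eu n} (hP : IsProxOf q γ P) {y v : Eu n} (hv : v ∈ subdiff q y) :
    P (y + γ⁻¹ • v) = y := by
  symm
  refine (hP (y + γ⁻¹ • v) y).2 ?_
  set p := P (y + γ⁻¹ • v)
  have h := hv p
  refine le_trans ?_ (add_le_add_left h _)
  rw [add_assoc, ← EReal.coe_add]
  refine add_le_add_right ?_ _
  rw [EReal.coe_le_coe_iff]
  have e1 : y - (y + γ⁻¹ • v) = - (γ⁻¹ • v) := by module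
  have e2 : p - (y + γ⁻¹ • v) = (p - y) - γ⁻¹ • v := by module
  rw [e1, e2, norm_neg, norm_sub_sq_real, inner_smul_right, real_inner_comm]
  have : γ / 2 * (‖p - y‖ ^ 2 - 2 * (γ⁻¹ * ⟪p - y, v⟫) + ‖γ⁻¹ • v‖ ^ 2)
    = γ / 2 * ‖p - y‖ ^ 2 - ⟪p - y, v⟫ + γ / 2 * ‖γ⁻¹ • v‖ ^ 2 := by
    field_simp
  rw [this]
  have : 0 ≤ γ / 2 * ‖p - y‖ ^ 2 := by positivity
  linarith

lemma prox_firm {n : ℕ} {q : Eu n → EReal} (hq : ProperLscConvex q) {γ : ℝ} (hγ : 0 < γ)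
    {P : Eu n → Eu n} (hP : IsProxOf q γ P) (x y : Eu n) :
    0 ≤ ⟪(x - y) - (P x - P y), P x - P y⟫ := by
  obtain ⟨r, hr⟩ := prox_fin hq hP x
  obtain ⟨s, hs⟩ := prox_fin hq hP y
  have h1 := prox_sub hq hP x (P y)
  have h2 := prox_sub hq hP y (P x)
  rw [hr, hs, ← EReal.coe_add, EReal.coe_le_coe_iff, inner_smul_left] at h1 h2
  simp only [conj_trivial] at h1 h2
  have e : ⟪(x - y) - (P x - P y), P x - P y⟫
      = - ⟪x - P x, P y - P x⟫ - ⟪y - P y, P x - P y⟫ := by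
    rw [← inner_neg_right, neg_sub, ← inner_sub_left]
    congr 1
    abel
  rw [e]
  have : 0 ≤ γ * (- ⟪x - P x, P y - P x⟫ - ⟪y - P y, P x - P y⟫) := by linarith
  exact nonneg_of_mul_nonneg_right this hγ

lemma prox_cont {n : ℕ} {q : Eu n → EReal} (hq : ProperLscConvex q) {γ : ℝ} (hγ : 0 < γ)
    {P : Eu n → Eu n} (hP : IsProxOf q γ P) : Continuous P := by
  have : LipschitzWith 1 P := by
    refine LipschitzWith.of_dist_le_mul fun x y => ?_
    rw [dist_eq_norm, dist_eq_norm, NNReal.coe_one, one_mul]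
    have h := prox_firm hq hγ hP x y
    rw [inner_sub_left, real_inner_self_eq_norm_sq] at h
    have h2 := real_inner_le_norm (x - y) (P x - P y)
    by_contra! hc
    nlinarith [norm_nonneg (x - y), norm_nonneg (P x - P y)]
  exact this.continuous

lemma prox_deriv {n : ℕ} {q : Eu n → EReal} (hq : ProperLscConvex q) {γ : ℝ} (hγ : 0 < γ)
    {P : Eu n → Eu n} (hP : IsProxOf q γ P) {x : Eu n} {B : Eu n →L[ℝ] Eu n}
    (hB : HasFDerivAt P B x) (h : Eu n) : 0 ≤ ⟪h - B h, B h⟫ := by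
  have hd : HasDerivAt (fun s : ℝ => P (x + s • h)) (B h) 0 := by
    have := hB.hasLineDerivAt h
    exact this
  have ht := (hasDerivAt_iff_tendsto_slope_zero.1 hd)
  simp only [zero_add, zero_smul, add_zero] at ht
  have ht2 := ((tendsto_const_nhds (x := h)).sub ht).inner ht (𝕜 := ℝ)
  refine ge_of_tendsto ht2 ?_
  filter_upwards [self_mem_nhdsWithin] with s hs
  have hs : s ≠ 0 := hs
  have := prox_firm hq hγ hP (x + s • h) x
  have e : h - s⁻¹ • (P (x + s • h) - P x) =
      s⁻¹ • ((x + s • h - x) - (P (x + s • h) - P x)) := by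
    rw [add_sub_cancel_left, smul_sub _ (s • h), smul_smul, inv_mul_cancel₀ hs, one_smul]
  rw [e, inner_smul_left, inner_smul_right]
  simp only [conj_trivial]
  rw [← mul_assoc]
  exact mul_nonneg (mul_self_nonneg _) this

lemma A_equiv {n : ℕ} (B : Eu n →L[ℝ] Eu n) (hB : ∀ h, 0 ≤ ⟪h - B h, B h⟫) {t : ℝ} (ht : 0 < t) :
    ∃ e : Eu n ≃L[ℝ] Eu n, (e : Eu n →L[ℝ] Eu n) = B + t • (1 - B) := by
  have hinj : Function.Injective (B + t • (1 - B) : Eu n →L[ℝ] Eu n) := by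
    rw [injective_iff_map_eq_zero]
    intro h hh
    have h1 : B h = - (t • (h - B h)) := by
      have : B h + t • (h - B h) = 0 := by simpa using hh
      exact eq_neg_of_add_eq_zero_left this
    have h2 := hB h
    have h2' : ⟪h - B h, B h⟫ = ⟪h - B h, - (t • (h - B h))⟫ := congrArg _ h1
    rw [h2', inner_neg_right, inner_smul_right, real_inner_self_eq_norm_sq] at h2
    have h3 : h - B h = 0 := by
      by_contra hne
      have : 0 < ‖h - B h‖ := norm_pos_iff.2 hne
      have : 0 < t * ‖h - B h‖ ^ 2 := by positivity
      linarith
    rw [h3, smul_zero, neg_zero] at h1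
    simpa [h1] using h3
  refine ⟨(LinearEquiv.ofInjectiveEndo (B + t • (1 - B) : Eu n →L[ℝ] Eu n).toLinearMap
    hinj).toContinuousLinearEquiv, ?_⟩
  ext1 x
  rfl

/-- Corollary 5.6: nonsingularity of all elements of `T_{u_γ}(x̄)` is
independent of `γ > 0` (both being equivalent to SCD regularity of `F + ∂q` around
`(x̄, 0)`). -/
theorem stmt11 {n : ℕ} (q : Eu n → EReal) (hq : ProperLscConvex q)
    (P : ℝ → Eu n → Eu n) (hP : ∀ γ > (0:ℝ), IsProxOf q γ (P γ))
    (F : Eu n → Eu n) (hF : ContDiff ℝ 1 F)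
    (xbar : Eu n) (hsol : -F xbar ∈ subdiff q xbar)
    (γ₀ : ℝ) (hγ₀ : 0 < γ₀)
    (hreg : ∀ B ∈ BSubdiff (P γ₀) (xbar - γ₀⁻¹ • F xbar),
      Function.Bijective ⇑(B * (1 - γ₀⁻¹ • fderiv ℝ F xbar) - 1)) :
    ∀ γ > (0:ℝ), ∀ B ∈ BSubdiff (P γ) (xbar - γ⁻¹ • F xbar),
      Function.Bijective ⇑(B * (1 - γ⁻¹ • fderiv ℝ F xbar) - 1) := by
  intro γ hγ B hBmem
  obtain ⟨u, V, hV, hu, hVB⟩ := hBmem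
  set t : ℝ := γ / γ₀ with htdef
  have ht : 0 < t := div_pos hγ hγ₀
  have hfirm : ∀ k h, 0 ≤ ⟪h - V k h, V k h⟫ := fun k h => prox_deriv hq hγ (hP γ hγ) (hV k) h
  have hfirmB : ∀ h, 0 ≤ ⟪h - B h, B h⟫ := by
    intro h
    have h1 : Tendsto (fun k => V k h) atTop (𝓝 (B h)) :=
      ((ContinuousLinearMap.apply ℝ (Eu n) h).continuous.tendsto B).comp hVB
    exact ge_of_tendsto' (((tendsto_const_nhds (x := h)).sub h1).inner h1 (𝕜 := ℝ))
      fun k => hfirm k h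
  obtain ⟨e, he⟩ := A_equiv B hfirmB ht
  choose ek hek using fun k => A_equiv (V k) (hfirm k) ht
  let φ : Eu n → Eu n := fun x => P γ x + t • (x - P γ x)
  let ψ : Eu n → Eu n := fun x => P γ₀ x + t⁻¹ • (x - P γ₀ x)
  have hφ0 : ∀ x, P γ₀ (φ x) = P γ x := by
    intro x
    have := prox_eq hγ₀ (hP γ₀ hγ₀) (prox_sub hq (hP γ hγ) x)
    rw [smul_smul] at this
    have e1 : γ₀⁻¹ * γ = t := by rw [htdef]; field_simp
    rwa [e1] at this
  have hψ0 : ∀ x, P γ (ψ x) = P γ₀ x := by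
    intro x
    have := prox_eq hγ (hP γ hγ) (prox_sub hq (hP γ₀ hγ₀) x)
    rw [smul_smul] at this
    have e1 : γ⁻¹ * γ₀ = t⁻¹ := by rw [htdef]; field_simp
    rwa [e1] at this
  have hψφ : ∀ x, ψ (φ x) = x := by
    intro x
    change P γ₀ (φ x) + t⁻¹ • (φ x - P γ₀ (φ x)) = x
    rw [hφ0]
    change P γ x + t⁻¹ • (P γ x + t • (x - P γ x) - P γ x) = x
    rw [add_sub_cancel_left, smul_smul, inv_mul_cancel₀ ht.ne', one_smul]
    abel
  have hφψ : ∀ x, φ (ψ x) = x := by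
    intro x
    change P γ (ψ x) + t • (ψ x - P γ (ψ x)) = x
    rw [hψ0]
    change P γ₀ x + t • (P γ₀ x + t⁻¹ • (x - P γ₀ x) - P γ₀ x) = x
    rw [add_sub_cancel_left, smul_smul, mul_inv_cancel₀ ht.ne', one_smul]
    abel
  have hc := prox_cont hq hγ (hP γ hγ)
  have hc0 := prox_cont hq hγ₀ (hP γ₀ hγ₀)
  have hφc : Continuous φ := by fun_prop
  have hψc : Continuous ψ := by fun_prop
  have hder : ∀ k, HasFDerivAt (P γ₀) (V k ∘L ((ek k).symm : Eu n →L[ℝ] Eu n)) (φ (u k)) := by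
    intro k
    have hφd : HasFDerivAt φ ((ek k : Eu n ≃L[ℝ] Eu n) : Eu n →L[ℝ] Eu n) (ψ (φ (u k))) := by
      rw [hψφ, hek]
      exact (hV k).add (((hasFDerivAt_id _).sub (hV k)).const_smul t)
    have hψd : HasFDerivAt ψ ((ek k).symm : Eu n →L[ℝ] Eu n) (φ (u k)) :=
      hφd.of_local_left_inverse hψc.continuousAt (Eventually.of_forall hφψ)
    have h1 : HasFDerivAt (P γ) (V k) (ψ (φ (u k))) := by rw [hψφ]; exact hV k
    have h2 := h1.comp (φ (u k)) hψd
    have h3 : P γ ∘ ψ = P γ₀ := funext hψ0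
    rwa [h3] at h2
  have hpt : φ (xbar - γ⁻¹ • F xbar) = xbar - γ₀⁻¹ • F xbar := by
    have h1 := prox_eq hγ (hP γ hγ) hsol
    rw [smul_neg, ← sub_eq_add_neg] at h1
    change P γ _ + t • (_ - P γ _) = _
    rw [h1]
    have e1 : t * γ⁻¹ = γ₀⁻¹ := by rw [htdef]; field_simp
    rw [← e1]
    module
  have hinv : Tendsto (fun k => ((ek k).symm : Eu n →L[ℝ] Eu n)) atTop
      (𝓝 (e.symm : Eu n →L[ℝ] Eu n)) := by
    have h1 : Tendsto (fun k => ((ek k) : Eu n →L[ℝ] Eu n)) atTop (𝓝 (e : Eu n →L[ℝ] Eu n)) := by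
      rw [he]
      simp only [hek]
      exact hVB.add ((tendsto_const_nhds.sub hVB).const_smul t)
    have h2 := ((contDiffAt_map_inverse (𝕜 := ℝ) (n := 0) e).continuousAt.tendsto).comp h1
    simpa [Function.comp_def] using h2
  have hmem : B ∘L (e.symm : Eu n →L[ℝ] Eu n) ∈ BSubdiff (P γ₀) (xbar - γ₀⁻¹ • F xbar) := by
    refine ⟨fun k => φ (u k), _, hder, ?_, ?_⟩
    · rw [← hpt]
      exact (hφc.tendsto _).comp hu
    · exact hVB.mul hinv
  have hinj0 := (hreg _ hmem).1
  have hinj : Function.Injective ⇑(B * (1 - γ⁻¹ • fderiv ℝ F xbar) - 1) := by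
    rw [injective_iff_map_eq_zero] at hinj0 ⊢
    intro h hh
    apply hinj0
    have h1 : B (h - γ⁻¹ • fderiv ℝ F xbar h) = h := by
      have : B (h - γ⁻¹ • fderiv ℝ F xbar h) - h = 0 := hh
      exact sub_eq_zero.1 this
    change B (e.symm (h - γ₀⁻¹ • fderiv ℝ F xbar h)) - h = 0
    have h2 : h - γ₀⁻¹ • fderiv ℝ F xbar h = e (h - γ⁻¹ • fderiv ℝ F xbar h) := by
      change _ = (e : Eu n →L[ℝ] Eu n) (h - γ⁻¹ • fderiv ℝ F xbar h)
      rw [he]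
      change _ = B (h - γ⁻¹ • fderiv ℝ F xbar h) + t • ((h - γ⁻¹ • fderiv ℝ F xbar h) -
        B (h - γ⁻¹ • fderiv ℝ F xbar h))
      rw [h1]
      have e1 : t * γ⁻¹ = γ₀⁻¹ := by rw [htdef]; field_simp
      rw [← e1]
      module
    rw [h2, e.symm_apply_apply, h1, sub_self]
  exact ⟨hinj, LinearMap.surjective_of_injective
    (f := (B * (1 - γ⁻¹ • fderiv ℝ F xbar) - 1 : Eu n →L[ℝ] Eu n).toLinearMap) hinj⟩
end
end

section
/- Let γ > 0 and let A, B, P be real n×n matrices with P invertible and M̃ := AᵀB + γ(I − B) invertible. Then the 2n×2n block matrix [[AᵀBP, −I], [γ(I − B)P, I]] is invertible, with inverse [[M⁻¹, M⁻¹], [−γ(I − B)PM⁻¹, I − γ(I − B)PM⁻¹]] where M := M̃P, and consequently [[BP, 0], [0, −I]] · [[AᵀBP, −I], [γ(I − B)P, I]]⁻¹ = [[BM̃⁻¹, BM̃⁻¹], [γ(I − B)M̃⁻¹, γ(I − B)M̃⁻¹ − I]]; in particular this product does not depend on P. -/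
open Matrix

noncomputable section

/-- the key block-matrix computation. If `P` is invertible and
`M̃ := AᵀB + γ(I − B)` is invertible, then the block matrix `[[AᵀBP, −I], [γ(I−B)P, I]]`
is invertible, its inverse is `[[M⁻¹, M⁻¹], [−γ(I−B)PM⁻¹, I − γ(I−B)PM⁻¹]]` with
`M := M̃P`, and `[[BP, 0], [0, −I]]` times this inverse equals
`[[BM̃⁻¹, BM̃⁻¹], [γ(I−B)M̃⁻¹, γ(I−B)M̃⁻¹ − I]]`, which does not depend on `P`. -/
theorem stmt12 {n : ℕ} (γ : ℝ) (hγ : 0 < γ)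
    (A B P : Matrix (Fin n) (Fin n) ℝ) (hP : IsUnit P)
    (hM : IsUnit (Aᵀ * B + γ • (1 - B))) :
    IsUnit (Matrix.fromBlocks (Aᵀ * B * P) (-1 : Matrix (Fin n) (Fin n) ℝ) (γ • (1 - B) * P) (1 : Matrix (Fin n) (Fin n) ℝ)) ∧
    (Matrix.fromBlocks (Aᵀ * B * P) (-1 : Matrix (Fin n) (Fin n) ℝ) (γ • (1 - B) * P) (1 : Matrix (Fin n) (Fin n) ℝ))⁻¹ =
      Matrix.fromBlocks ((Aᵀ * B + γ • (1 - B)) * P)⁻¹ ((Aᵀ * B + γ • (1 - B)) * P)⁻¹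
        (-(γ • (1 - B) * P * ((Aᵀ * B + γ • (1 - B)) * P)⁻¹))
        (1 - γ • (1 - B) * P * ((Aᵀ * B + γ • (1 - B)) * P)⁻¹) ∧
    Matrix.fromBlocks (B * P) (0 : Matrix (Fin n) (Fin n) ℝ) (0 : Matrix (Fin n) (Fin n) ℝ) (-1 : Matrix (Fin n) (Fin n) ℝ) *
        (Matrix.fromBlocks (Aᵀ * B * P) (-1 : Matrix (Fin n) (Fin n) ℝ) (γ • (1 - B) * P) (1 : Matrix (Fin n) (Fin n) ℝ))⁻¹ =
      Matrix.fromBlocks (B * (Aᵀ * B + γ • (1 - B))⁻¹) (B * (Aᵀ * B + γ • (1 - B))⁻¹)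
        (γ • (1 - B) * (Aᵀ * B + γ • (1 - B))⁻¹)
        (γ • (1 - B) * (Aᵀ * B + γ • (1 - B))⁻¹ - 1) := by
  generalize Aᵀ * B = X at *
  generalize γ • (1 - B) = Y at *
  have hPd := (Matrix.isUnit_iff_isUnit_det P).1 hP
  have hN : (X * P + Y * P) * ((X + Y) * P)⁻¹ = 1 := by
    rw [← add_mul]
    exact Matrix.mul_nonsing_inv _ ((Matrix.isUnit_iff_isUnit_det _).1 (hM.mul hP))
  have hPN : P * ((X + Y) * P)⁻¹ = (X + Y)⁻¹ := by
    rw [Matrix.mul_inv_rev, ← mul_assoc, Matrix.mul_nonsing_inv _ hPd, one_mul]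
  generalize ((X + Y) * P)⁻¹ = N at *
  have key : Matrix.fromBlocks (X * P) (-1 : Matrix (Fin n) (Fin n) ℝ) (Y * P) 1 *
      Matrix.fromBlocks N N (-(Y * P * N)) (1 - Y * P * N) = 1 := by
    rw [Matrix.fromBlocks_multiply, ← Matrix.fromBlocks_one]
    rw [add_mul] at hN
    congr 1
    · rw [neg_one_mul, neg_neg, hN]
    · rw [neg_one_mul, neg_sub, ← add_sub_assoc, hN, sub_self]
    · noncomm_ring
    · noncomm_ring
  have hinv := Matrix.inv_eq_right_inv key
  refine ⟨IsUnit.of_mul_eq_one _ key, hinv, ?_⟩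
  rw [hinv, Matrix.fromBlocks_multiply, ← hPN]
  congr 1 <;> noncomm_ring
end
end

section
/- Let γ > 0, let W ∈ R^{n×n} be invertible, let B ∈ R^{n×n} be symmetric, let A ∈ R^{n×n}, and let u, Δx ∈ R^n. Set Y* := BW and X* := γ(I − B)W. Then (Y*ᵀA + X*ᵀ)Δx = (γY*ᵀ + X*ᵀ)u holds if and only if (B(I − γ⁻¹A) − I)Δx = −u. Consequently, if both Algorithm 6 (the implementable SCD semismooth* Newton method for 0 ∈ F(x) + ∂q(x), with Newton system (Y*ᵀF'(x^k) + X*ᵀ)Δx = (γY*ᵀ + X*ᵀ)u_γ(x^k)) and Algorithm 7 (the G-semismooth Newton method with system (B(I − γ⁻¹F'(x^k)) − I)Δx = −u_γ(x^k)) start an iteration from the same point x^k with the same parameter γ and matched matrices (Y*; X*) = (B; γ(I − B))W, they produce the same next iterate x^{k+1}. -/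
open Filter Metric ContinuousLinearMap Asymptotics
open scoped Topology RealInnerProductSpace

noncomputable section

set_option maxHeartbeats 1000000

theorem aux13 {n : ℕ} (γ : ℝ) (hγ : 0 < γ)
    (W B A : Eu n →L[ℝ] Eu n) (hW : Function.Bijective ⇑W) (hB : IsSelfAdjoint B)
    (u d : Eu n) :
    ((adjoint (B * W) * A + adjoint (γ • (1 - B) * W) : Eu n →L[ℝ] Eu n)) d
        = ((γ • adjoint (B * W) + adjoint (γ • (1 - B) * W) : Eu n →L[ℝ] Eu n)) u ↔
      ((B * (1 - γ⁻¹ • A) - 1 : Eu n →L[ℝ] Eu n)) d = -u := by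
  have hinj : ∀ x y : Eu n, adjoint W x = adjoint W y → x = y := by
    intro x y h
    refine ext_inner_right ℝ fun z => ?_
    obtain ⟨w, rfl⟩ := hW.2 z
    rw [← ContinuousLinearMap.adjoint_inner_left, ← ContinuousLinearMap.adjoint_inner_left, h]
  have h1 : adjoint (B * W) = adjoint W * B := by
    rw [← ContinuousLinearMap.star_eq_adjoint, star_mul, hB.star_eq,
      ContinuousLinearMap.star_eq_adjoint]
  have h2 : adjoint (γ • (1 - B) * W) = adjoint W * (γ • (1 - B)) := by
    rw [← ContinuousLinearMap.star_eq_adjoint, star_mul, star_smul, star_sub, hB.star_eq,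
      ContinuousLinearMap.star_eq_adjoint, star_one, star_trivial]
  have hl : (adjoint W * B * A + adjoint W * (γ • (1 - B)) : Eu n →L[ℝ] Eu n) d
      = adjoint W (B (A d) + γ • (d - B d)) := by
    simp
  have hr : (γ • (adjoint W * B) + adjoint W * (γ • (1 - B)) : Eu n →L[ℝ] Eu n) u
      = adjoint W (γ • u) := by
    simp [smul_sub]
  have hm : (B * (1 - γ⁻¹ • A) - 1 : Eu n →L[ℝ] Eu n) d = B d - γ⁻¹ • B (A d) - d := by
    simp
  rw [h1, h2, hl, hr, hm]
  have key : B (A d) + γ • (d - B d) - γ • u = -(γ • ((B d - γ⁻¹ • B (A d) - d) - -u)) := by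
    simp only [smul_sub, smul_neg, smul_inv_smul₀ hγ.ne']
    abel
  constructor
  · intro h
    have h' := hinj _ _ h
    rw [← sub_eq_zero, key, neg_eq_zero, smul_eq_zero] at h'
    exact sub_eq_zero.1 (h'.resolve_left hγ.ne')
  · intro h
    congr 1
    rw [← sub_eq_zero, key, h]
    simp

/-- Lemma 5.8: with `Y* := BW`, `X* := γ(I−B)W` (`W` invertible, `B`
symmetric), the SCD semismooth* Newton system `(Y*ᵀA + X*ᵀ)Δx = (γY*ᵀ + X*ᵀ)u` is
equivalent to the G-semismooth Newton system `(B(I − γ⁻¹A) − I)Δx = −u`; consequently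
Algorithm 6 and Algorithm 7 produce the same set of next iterates from a common point. -/
theorem stmt13 {n : ℕ} (γ : ℝ) (hγ : 0 < γ)
    (W B A : Eu n →L[ℝ] Eu n) (hW : Function.Bijective ⇑W) (hB : IsSelfAdjoint B)
    (u Δx : Eu n)
    (q : Eu n → EReal) (hq : ProperLscConvex q)
    (P F : Eu n → Eu n) (hP : IsProxOf q γ P)
    (xk : Eu n) (hF : DifferentiableAt ℝ F xk) :
    (((adjoint (B * W) * A + adjoint (γ • (1 - B) * W) : Eu n →L[ℝ] Eu n)) Δx
        = ((γ • adjoint (B * W) + adjoint (γ • (1 - B) * W) : Eu n →L[ℝ] Eu n)) u ↔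
      ((B * (1 - γ⁻¹ • A) - 1 : Eu n →L[ℝ] Eu n)) Δx = -u) ∧
    (∀ Bk : Eu n →L[ℝ] Eu n, Bk ∈ BSubdiff P (xk - γ⁻¹ • F xk) → IsSelfAdjoint Bk →
      ∀ Wk : Eu n →L[ℝ] Eu n, Function.Bijective ⇑Wk →
        {y : Eu n | ∃ d : Eu n,
            ((adjoint (Bk * Wk) * fderiv ℝ F xk + adjoint (γ • (1 - Bk) * Wk)
                : Eu n →L[ℝ] Eu n)) d
              = ((γ • adjoint (Bk * Wk) + adjoint (γ • (1 - Bk) * Wk) : Eu n →L[ℝ] Eu n))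
                  (P (xk - γ⁻¹ • F xk) - xk) ∧
            y = xk + d} =
        {y : Eu n | ∃ d : Eu n,
            ((Bk * (1 - γ⁻¹ • fderiv ℝ F xk) - 1 : Eu n →L[ℝ] Eu n)) d
              = -(P (xk - γ⁻¹ • F xk) - xk) ∧
            y = xk + d}) := by
  refine ⟨aux13 γ hγ W B A hW hB u Δx, ?_⟩
  intro Bk _ hBk Wk hWk
  ext y
  simp only [Set.mem_setOf_eq]
  exact exists_congr fun d => and_congr_left' (aux13 γ hγ Wk Bk _ hWk hBk _ d)
end
end
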